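/- arXiv:2512.20089 — 5 statements merged into one kernel-verified Lean document; each statement's English description precedes it below -/
import Mathlib

section
/- Let G be a finite simple graph and let a, b, m be integers with 1 ≤ a ≤ b and 0 ≤ m ≤ b, with G having at least m edges. Then G is fractional (a,b,m)-covered if and only if for every S ⊆ V(G), it holds that Σ_{v ∈ T} d_{G−S}(v) − a|T| + b|S| ≥ max over all subgraphs H of G with exactly m edges of { Σ_{x ∈ S} d_H(x) − e_H(T,S) + Θ(S,T,H) }, where T = {x ∈ V(G)∖S : d_{G−S}(x) ≤ a−1}, and Θ(S,T,H) = Σ over all vertices x ∈ T satisfying e_H(x,S) ≥ 2 and 1 ≤ d_{G∖E(H)−S}(x) − a + d_H(x) ≤ e_H(x,S) − 1 of the quantity d_{G∖E(H)−S}(x) − a + d_H(x). -/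
open Finset

/-- A fractional `[a,b]`-factor of `G`: a function `h` on (potential) edges taking values
in `[0,1]` on edges of `G`, such that for every vertex `u` the total weight of edges of `G`
incident with `u` lies between `a` and `b`. -/
def SimpleGraph.IsFracFactor {V : Type*} [Fintype V] [DecidableEq V]
    (G : SimpleGraph V) [DecidableRel G.Adj] (a b : ℕ) (h : Sym2 V → ℝ) : Prop :=
  (∀ e ∈ G.edgeSet, 0 ≤ h e ∧ h e ≤ 1) ∧
  ∀ u : V, (a : ℝ) ≤ ∑ e ∈ G.incidenceFinset u, h e ∧
    ∑ e ∈ G.incidenceFinset u, h e ≤ (b : ℝ)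

/-- `G` is fractional `(a,b,m)`-covered: for every set `M` of `m` edges of `G` there is a
fractional `[a,b]`-factor `h` of `G` with `h e = 1` for all `e ∈ M`. -/
def SimpleGraph.IsFracABMCovered {V : Type*} [Fintype V] [DecidableEq V]
    (G : SimpleGraph V) [DecidableRel G.Adj] (a b m : ℕ) : Prop :=
  ∀ M : Finset (Sym2 V), ↑M ⊆ G.edgeSet → M.card = m →
    ∃ h : Sym2 V → ℝ, G.IsFracFactor a b h ∧ ∀ e ∈ M, h e = 1

variable {V : Type*} [Fintype V] [DecidableEq V]

/-- `d_{G-S}(x)`: the degree of `x` in the induced subgraph of `G` on `V(G) ∖ S`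
(for `x ∉ S` this is the number of neighbors of `x` outside of `S`). -/
def SimpleGraph.degOut (G : SimpleGraph V) [DecidableRel G.Adj] (S : Finset V) (x : V) : ℕ :=
  (G.neighborFinset x \ S).card

/-- `T = {x ∈ V(G) ∖ S : d_{G-S}(x) ≤ a - 1}`. -/
def SimpleGraph.Tset (G : SimpleGraph V) [DecidableRel G.Adj] (a : ℕ) (S : Finset V) :
    Finset V :=
  Finset.univ.filter fun x => x ∉ S ∧ G.degOut S x ≤ a - 1

/-- `d_H(x)`: the degree of `x` in the subgraph `H` given by its edge set `M`. -/
def degH (M : Finset (Sym2 V)) (x : V) : ℕ :=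
  (Finset.univ.filter fun y => s(x, y) ∈ M).card

/-- `e_H(x,S)`: the number of edges of `H` (with edge set `M`) joining `x` to a vertex of `S`. -/
def eHxS (M : Finset (Sym2 V)) (x : V) (S : Finset V) : ℕ :=
  (S.filter fun y => s(x, y) ∈ M).card

/-- `e_H(T,S)`: the number of edges of `H` (with edge set `M`) with one endpoint in `T`
and the other in `S`. -/
def eHTS (M : Finset (Sym2 V)) (T S : Finset V) : ℕ :=
  (M.filter fun e => ∃ x ∈ T, ∃ y ∈ S, e = s(x, y)).card

/-- `d_{G∖E(H)-S}(x)`: the degree of `x` in the graph obtained from `G` by deleting all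
edges of `H` (edge set `M`) and all vertices of `S`. -/
def SimpleGraph.degMinusH (G : SimpleGraph V) [DecidableRel G.Adj] (M : Finset (Sym2 V))
    (S : Finset V) (x : V) : ℕ :=
  ((G.neighborFinset x \ S).filter fun y => s(x, y) ∉ M).card

/-- `Θ(S,T,H)`: the sum over all `x ∈ T` with `e_H(x,S) ≥ 2` and
`1 ≤ d_{G∖E(H)-S}(x) - a + d_H(x) ≤ e_H(x,S) - 1` of `d_{G∖E(H)-S}(x) - a + d_H(x)`. -/
def SimpleGraph.theta (G : SimpleGraph V) [DecidableRel G.Adj] (a : ℕ)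
    (M : Finset (Sym2 V)) (S T : Finset V) : ℤ :=
  ∑ x ∈ T.filter (fun x => 2 ≤ eHxS M x S ∧
      1 ≤ (G.degMinusH M S x : ℤ) - (a : ℤ) + (degH M x : ℤ) ∧
      (G.degMinusH M S x : ℤ) - (a : ℤ) + (degH M x : ℤ) ≤ (eHxS M x S : ℤ) - 1),
    ((G.degMinusH M S x : ℤ) - (a : ℤ) + (degH M x : ℤ))

theorem SimpleGraph.sum_incidenceFinset_eq_sum_neighborFinset
    (G : SimpleGraph V) [DecidableRel G.Adj] (h : Sym2 V → ℝ) (u : V) :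
    ∑ e ∈ G.incidenceFinset u, h e = ∑ v ∈ G.neighborFinset u, h s(u, v) := by
  symm
  refine Finset.sum_bij (fun v _ => s(u, v)) ?_ ?_ ?_ ?_
  · intro v hv
    simpa [SimpleGraph.mem_incidenceFinset, SimpleGraph.mk'_mem_incidenceSet_iff] using hv
  · intro v _ w _ hvw
    exact Sym2.congr_right.1 hvw
  · intro e he
    rw [SimpleGraph.mem_incidenceFinset] at he
    obtain ⟨he, hu⟩ := he
    obtain ⟨v, rfl⟩ := hu
    exact ⟨v, by simpa using he, rfl⟩
  · intros
    rfl

theorem Finset.sum_sum_eq_zero_of_antisymm {ι : Type*} [Fintype ι] (Q : ι → ι → ℝ)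
    (hQ : ∀ u v, Q u v = -Q v u) :
    ∑ u, ∑ v, Q u v = 0 := by
  have h₁ : ∑ u, ∑ v, Q u v = -∑ u, ∑ v, Q u v := by
    conv_lhs => rw [Finset.sum_comm]
    rw [← Finset.sum_neg_distrib]
    refine Finset.sum_congr rfl fun u _ => ?_
    rw [← Finset.sum_neg_distrib]
    exact Finset.sum_congr rfl fun v _ => hQ v u
  linarith

theorem integral_indicator_Ioc_one (s t : ℝ) :
    ∫ θ, (Set.Ioc s t).indicator (fun _ => (1 : ℝ)) θ = max (t - s) 0 := by
  rw [MeasureTheory.integral_indicator_const _ measurableSet_Ioc, Real.volume_real_Ioc]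
  simp

theorem integrable_indicator_Ioc_one (s t : ℝ) :
    MeasureTheory.Integrable ((Set.Ioc s t).indicator fun _ => (1 : ℝ)) := by
  refine (MeasureTheory.integrable_indicator_iff measurableSet_Ioc).2 ?_
  exact MeasureTheory.integrableOn_const (by simp)

/-- The cut condition implies its weighted form, by integrating it over the level sets
`{y ≥ θ}` and `{y ≤ -θ}` of the weight. -/
theorem SimpleGraph.weighted_cut_nonneg (G : SimpleGraph V) [DecidableRel G.Adj] (g f : V → ℝ)
    (hST : ∀ S T : Finset V, Disjoint S T →
      0 ≤ ∑ x ∈ S, f x + ∑ x ∈ T, ((G.degOut S x : ℝ) - g x)) (y : V → ℝ) :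
    0 ≤ ∑ x, f x * max (y x) 0 - ∑ x, g x * max (-y x) 0 +
      ∑ u, ∑ v, if G.Adj u v then max (-y u - max 0 (y v)) 0 else 0 := by
  let I (s t θ : ℝ) : ℝ := (Set.Ioc s t).indicator (fun _ => (1 : ℝ)) θ
  have hI (s t : ℝ) : ∫ θ, I s t θ = max (t - s) 0 := integral_indicator_Ioc_one s t
  have hint (s t : ℝ) : MeasureTheory.Integrable (I s t) := integrable_indicator_Ioc_one s t
  let c (u v : V) : ℝ := if G.Adj u v then 1 else 0
  let F (θ : ℝ) : ℝ := ∑ x, f x * I 0 (y x) θ - ∑ x, g x * I 0 (-y x) θ +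
    ∑ u, ∑ v, c u v * I (max 0 (y v)) (-y u) θ
  have i₁ : MeasureTheory.Integrable fun θ => ∑ x, f x * I 0 (y x) θ :=
    MeasureTheory.integrable_finsetSum _ fun x _ => (hint _ _).const_mul _
  have i₂ : MeasureTheory.Integrable fun θ => ∑ x, g x * I 0 (-y x) θ :=
    MeasureTheory.integrable_finsetSum _ fun x _ => (hint _ _).const_mul _
  have i₃ : MeasureTheory.Integrable fun θ => ∑ u, ∑ v, c u v * I (max 0 (y v)) (-y u) θ :=
    MeasureTheory.integrable_finsetSum _ fun u _ =>
      MeasureTheory.integrable_finsetSum _ fun v _ => (hint _ _).const_mul _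
  have hF : ∫ θ, F θ = ∑ x, f x * max (y x) 0 - ∑ x, g x * max (-y x) 0 +
      ∑ u, ∑ v, if G.Adj u v then max (-y u - max 0 (y v)) 0 else 0 := by
    simp only [F]
    rw [MeasureTheory.integral_add 
        (f := fun θ => ∑ x, f x * I 0 (y x) θ - ∑ x, g x * I 0 (-y x) θ)
        (i₁.sub i₂) i₃, MeasureTheory.integral_sub i₁ i₂,
      MeasureTheory.integral_finsetSum _ fun x _ => (hint _ _).const_mul _,
      MeasureTheory.integral_finsetSum _ fun x _ => (hint _ _).const_mul _,
      MeasureTheory.integral_finsetSum _ fun u _ =>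
        MeasureTheory.integrable_finsetSum _ fun v _ => (hint _ _).const_mul _]
    congr 1
    · simp [MeasureTheory.integral_const_mul, hI]
    · refine Finset.sum_congr rfl fun u _ => ?_
      rw [MeasureTheory.integral_finsetSum _ fun v _ => (hint _ _).const_mul _]
      refine Finset.sum_congr rfl fun v _ => ?_
      rw [MeasureTheory.integral_const_mul, hI]
      simp [c]
  rw [← hF]
  refine MeasureTheory.integral_nonneg fun θ => ?_
  rcases le_or_gt θ 0 with hθ | hθ
  · have h₀ (s t : ℝ) (hs : 0 ≤ s) : I s t θ = 0 :=
      Set.indicator_of_notMem (fun h => absurd h.1 (by linarith)) _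
    simp [F, h₀]
  · classical
    have key := hST (univ.filter fun x => θ ≤ y x) (univ.filter fun x => θ ≤ -y x) (by
      rw [Finset.disjoint_filter]
      intro x _ h₁ h₂
      linarith)
    have hI' (t : ℝ) : I 0 t θ = if θ ≤ t then 1 else 0 := by
      simp [I, Set.indicator_apply, hθ]
    have hFθ : F θ = ∑ x ∈ univ.filter (fun x => θ ≤ y x), f x +
        ∑ x ∈ univ.filter (fun x => θ ≤ -y x),
          ((G.degOut (univ.filter fun x => θ ≤ y x) x : ℝ) - g x) := by
      simp only [F, hI', Finset.sum_filter, mul_ite, mul_one, mul_zero]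
      rw [sub_add, sub_eq_add_neg, ← Finset.sum_sub_distrib, ← Finset.sum_neg_distrib]
      congr 1
      refine Finset.sum_congr rfl fun u _ => ?_
      by_cases hu : θ ≤ -y u
      · have hdeg : ∑ v, c u v * I (max 0 (y v)) (-y u) θ =
            (G.degOut (univ.filter fun x => θ ≤ y x) u : ℝ) := by
          have hcI (v : V) : c u v * I (max 0 (y v)) (-y u) θ =
              if G.Adj u v ∧ y v < θ then 1 else 0 := by
            by_cases huv : G.Adj u v <;> simp [c, I, Set.indicator_apply, hθ, hu, huv]
          simp only [hcI]
          rw [Finset.sum_boole, SimpleGraph.degOut]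
          congr 2
          ext v
          simp
        simp [hu, hdeg]
      · have hz (v : V) : I (max 0 (y v)) (-y u) θ = 0 :=
          Set.indicator_of_notMem (fun h => hu h.2) _
        simp [hu, hz]
    change 0 ≤ F θ
    rw [hFθ]
    exact key

/-- The fractional `(g,f)`-factor theorem. -/
theorem SimpleGraph.exists_fractional_factor_iff (G : SimpleGraph V) [DecidableRel G.Adj]
    (g f : V → ℝ) (hgf : g ≤ f) :
    (∃ h : Sym2 V → ℝ, (∀ e ∈ G.edgeSet, 0 ≤ h e ∧ h e ≤ 1) ∧
      ∀ u, g u ≤ ∑ v ∈ G.neighborFinset u, h s(u, v) ∧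
        ∑ v ∈ G.neighborFinset u, h s(u, v) ≤ f u) ↔
    ∀ S T : Finset V, Disjoint S T →
      0 ≤ ∑ x ∈ S, f x + ∑ x ∈ T, ((G.degOut S x : ℝ) - g x) := by
  constructor
  · rintro ⟨h, h01, hh⟩ S T -
    have hS : ∑ x ∈ S, ∑ v ∈ G.neighborFinset x, h s(x, v) ≤ ∑ x ∈ S, f x :=
      Finset.sum_le_sum fun x _ => (hh x).2
    have hT : ∑ x ∈ T, g x ≤ ∑ x ∈ T, ∑ v ∈ G.neighborFinset x, h s(x, v) :=
      Finset.sum_le_sum fun x _ => (hh x).1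
    have hsplit : ∀ x ∈ T, ∑ v ∈ G.neighborFinset x, h s(x, v) ≤
        (G.degOut S x : ℝ) + ∑ v ∈ S, if G.Adj x v then h s(x, v) else 0 := by
      intro x _
      rw [← Finset.sum_inter_add_sum_sdiff (G.neighborFinset x) S, add_comm]
      refine add_le_add ?_ (le_of_eq ?_)
      · rw [SimpleGraph.degOut, Finset.card_eq_sum_ones, Nat.cast_sum]
        refine Finset.sum_le_sum fun v hv => ?_
        have hv' : G.Adj x v := by simpa using (Finset.mem_sdiff.1 hv).1
        simpa using (h01 s(x, v) hv').2
      · rw [← Finset.sum_filter]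
        refine Finset.sum_congr ?_ fun _ _ => rfl
        ext v
        simp [and_comm]
    have hle := Finset.sum_le_sum hsplit
    rw [Finset.sum_add_distrib, Finset.sum_comm] at hle
    have hcross : ∑ v ∈ S, ∑ x ∈ T, (if G.Adj x v then h s(x, v) else 0) ≤
        ∑ x ∈ S, ∑ v ∈ G.neighborFinset x, h s(x, v) := by
      refine Finset.sum_le_sum fun v _ => ?_
      rw [← Finset.sum_filter]
      calc ∑ x ∈ T with G.Adj x v, h s(x, v) = ∑ x ∈ T with G.Adj x v, h s(v, x) :=
            Finset.sum_congr rfl fun x _ => by rw [Sym2.eq_swap]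
        _ ≤ _ := by
          refine Finset.sum_le_sum_of_subset_of_nonneg ?_ ?_
          · intro x hx
            simpa [G.adj_comm] using (Finset.mem_filter.1 hx).2
          · intro x hx _
            exact (h01 s(v, x) (by simpa using hx)).1
    rw [Finset.sum_sub_distrib]
    linarith
  · intro hST
    by_contra hno
    let L : (Sym2 V → ℝ) →ₗ[ℝ] (V → ℝ) :=
      { toFun := fun h u => ∑ v ∈ G.neighborFinset u, h s(u, v)
        map_add' := fun h k => by ext u; simp [Finset.sum_add_distrib]
        map_smul' := fun r h => by ext u; simp [Finset.mul_sum] }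
    have hLc : Continuous L := L.continuous_of_finiteDimensional
    have hdisj : Disjoint (Set.Icc g f) (L '' Set.Icc 0 1) := by
      rw [Set.disjoint_left]
      rintro _ hd ⟨h, hh, rfl⟩
      exact hno ⟨h, fun e _ => ⟨hh.1 e, hh.2 e⟩, fun u => ⟨hd.1 u, hd.2 u⟩⟩
    obtain ⟨φ, s, t, hs, hst, ht⟩ := geometric_hahn_banach_compact_closed
      (convex_Icc g f) isCompact_Icc ((convex_Icc (0 : Sym2 V → ℝ) 1).linear_image L)
      (isCompact_Icc.image hLc).isClosed hdisj
    let y : V → ℝ := fun i => φ (Pi.single i 1)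
    have hφ (z : V → ℝ) : φ z = ∑ i, z i * y i := by
      conv_lhs => rw [pi_eq_sum_univ' z]
      simp [y, map_sum]
    have hc := hs (fun i => if 0 < y i then f i else g i)
      ⟨fun i => by dsimp only; split_ifs; exacts [hgf i, le_rfl],
        fun i => by dsimp only; split_ifs; exacts [le_rfl, hgf i]⟩
    let k : Sym2 V → ℝ := Sym2.lift ⟨fun u v => if y u + y v < 0 then 1 else 0,
      fun u v => by simp only [add_comm]⟩
    have hd := ht _ ⟨k, ⟨fun e => by
        induction e with | _ u v => simp only [k, Sym2.lift_mk, Pi.zero_apply]; split_ifs <;> simp,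
        fun e => by
        induction e with | _ u v => simp only [k, Sym2.lift_mk, Pi.one_apply]; split_ifs <;> simp⟩,
        rfl⟩
    have hw := G.weighted_cut_nonneg g f hST y
    rw [hφ] at hc hd
    have hc' : ∑ i, (if 0 < y i then f i else g i) * y i =
        ∑ x, f x * max (y x) 0 - ∑ x, g x * max (-y x) 0 := by
      rw [← Finset.sum_sub_distrib]
      refine Finset.sum_congr rfl fun x _ => ?_
      split_ifs with hx
      · rw [max_eq_left hx.le, max_eq_right (by linarith)]
        ring
      · rw [max_eq_right (by linarith), max_eq_left (by linarith)]
        ring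
    have hanti := Finset.sum_sum_eq_zero_of_antisymm
      (fun u v => (if G.Adj u v then (if y u + y v < 0 then 1 else 0) * y u else 0) +
        if G.Adj u v then max (-y u - max 0 (y v)) 0 else 0) (by
      intro u v
      by_cases huv : G.Adj u v
      · simp only [huv, huv.symm, if_true, add_comm (y v) (y u)]
        rcases le_total 0 (y u) with h₁ | h₁ <;> rcases le_total 0 (y v) with h₂ | h₂ <;>
          split_ifs with h₃ <;> simp only [max_def] <;> split_ifs <;> linarith
      · simp [huv, G.adj_comm v u])
    simp only [Finset.sum_add_distrib] at hanti
    have hd' : ∑ i, L k i * y i =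
        ∑ u, ∑ v, if G.Adj u v then (if y u + y v < 0 then 1 else 0) * y u else 0 := by
      refine Finset.sum_congr rfl fun u _ => ?_
      rw [← Finset.sum_filter, ← SimpleGraph.neighborFinset_eq_filter, ← Finset.sum_mul]
      rfl
    rw [hd'] at hd
    rw [hc'] at hc
    linarith

theorem eHTS_eq_sum_eHxS {W : Type*} [DecidableEq W] (M : Finset (Sym2 W)) {S T : Finset W}
    (hST : Disjoint S T) :
    eHTS M T S = ∑ x ∈ T, eHxS M x S := by
  simp only [eHxS]
  rw [← Finset.card_sigma, eHTS]
  symm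
  refine Finset.card_bij (fun p _ => s(p.1, p.2)) ?_ ?_ ?_
  · rintro ⟨x, y⟩ hp
    simp only [mem_sigma, mem_filter] at hp ⊢
    exact ⟨hp.2.2, x, hp.1, y, hp.2.1, rfl⟩
  · rintro ⟨x, y⟩ hp ⟨x', y'⟩ hp' heq
    simp only [mem_sigma, mem_filter] at hp hp'
    rcases Sym2.eq_iff.1 heq with ⟨rfl, rfl⟩ | ⟨rfl, rfl⟩
    · rfl
    · exact absurd hp.1 (Finset.disjoint_left.1 hST hp'.2.1)
  · intro e he
    obtain ⟨heM, x, hx, y, hy, rfl⟩ := Finset.mem_filter.1 he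
    exact ⟨⟨x, y⟩, by simp [hx, hy, heM], rfl⟩

theorem SimpleGraph.degMinusH_add_degH (G : SimpleGraph V) [DecidableRel G.Adj]
    {M : Finset (Sym2 V)} (hM : ↑M ⊆ G.edgeSet) (S : Finset V) (x : V) :
    G.degMinusH M S x + degH M x = G.degOut S x + eHxS M x S := by
  have hH : degH M x = ((G.neighborFinset x \ S).filter fun y => s(x, y) ∈ M).card +
      eHxS M x S := by
    rw [degH, eHxS, ← Finset.card_union_of_disjoint]
    · congr 1
      ext y
      have : s(x, y) ∈ M → G.Adj x y := fun h => hM h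
      simp only [mem_filter, mem_univ, true_and, mem_union, mem_sdiff, mem_neighborFinset]
      tauto
    · rw [Finset.disjoint_left]
      intro y h₁ h₂
      exact (Finset.mem_sdiff.1 (Finset.mem_filter.1 h₁).1).2 (Finset.mem_filter.1 h₂).1
  rw [hH, SimpleGraph.degMinusH, SimpleGraph.degOut,
    ← Finset.card_filter_add_card_filter_not (s := G.neighborFinset x \ S) fun y => s(x, y) ∈ M]
  ring

theorem SimpleGraph.degOut_deleteEdges (G : SimpleGraph V) [DecidableRel G.Adj]
    (M : Finset (Sym2 V)) [DecidableRel (G.deleteEdges (M : Set (Sym2 V))).Adj]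
    (S : Finset V) (x : V) :
    (G.deleteEdges (M : Set (Sym2 V))).degOut S x = G.degMinusH M S x := by
  rw [SimpleGraph.degOut, SimpleGraph.degMinusH]
  congr 1
  ext y
  simp only [mem_sdiff, mem_neighborFinset, deleteEdges_adj, mem_coe, mem_filter]
  tauto

theorem SimpleGraph.sum_neighborFinset_eq_deleteEdges_add_degH (G : SimpleGraph V)
    [DecidableRel G.Adj] {M : Finset (Sym2 V)} (hM : ↑M ⊆ G.edgeSet)
    [DecidableRel (G.deleteEdges (M : Set (Sym2 V))).Adj] (h : Sym2 V → ℝ)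
    (hh : ∀ e ∈ M, h e = 1) (u : V) :
    ∑ v ∈ G.neighborFinset u, h s(u, v) =
      ∑ v ∈ (G.deleteEdges (M : Set (Sym2 V))).neighborFinset u, h s(u, v) + degH M u := by
  rw [← Finset.sum_filter_not_add_sum_filter (G.neighborFinset u) fun v => s(u, v) ∈ M]
  congr 1
  · refine Finset.sum_congr ?_ fun _ _ => rfl
    ext v
    simp
  · rw [degH, Finset.card_eq_sum_ones, Nat.cast_sum]
    refine Finset.sum_congr ?_ fun v hv => ?_
    · ext v
      have : s(u, v) ∈ M → G.Adj u v := fun h => hM h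
      simp only [mem_filter, mem_univ, true_and, mem_neighborFinset]
      tauto
    · simpa using hh _ (Finset.mem_filter.1 hv).2

theorem SimpleGraph.exists_isFracFactor_eq_one_iff (G : SimpleGraph V) [DecidableRel G.Adj]
    {a b : ℕ} (hab : a ≤ b) {M : Finset (Sym2 V)} (hM : ↑M ⊆ G.edgeSet) :
    (∃ h : Sym2 V → ℝ, G.IsFracFactor a b h ∧ ∀ e ∈ M, h e = 1) ↔
      ∀ S T : Finset V, Disjoint S T →
        0 ≤ ∑ x ∈ S, ((b : ℤ) - degH M x) +
          ∑ x ∈ T, ((G.degOut S x : ℤ) + eHxS M x S - a) := by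
  classical
  have key := (G.deleteEdges (M : Set (Sym2 V))).exists_fractional_factor_iff
    (fun x => (a : ℝ) - degH M x) (fun x => (b : ℝ) - degH M x)
    (fun x => sub_le_sub_right (Nat.cast_le.2 hab) _)
  have hcond (S T : Finset V) :
      (0 ≤ ∑ x ∈ S, ((b : ℝ) - degH M x) +
        ∑ x ∈ T, (((G.deleteEdges (M : Set (Sym2 V))).degOut S x : ℝ) - (a - degH M x))) ↔
      0 ≤ ∑ x ∈ S, ((b : ℤ) - degH M x) +
          ∑ x ∈ T, ((G.degOut S x : ℤ) + eHxS M x S - a) := by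
    rw [← Int.cast_nonneg_iff (R := ℝ)]
    push_cast
    have (x : V) : (((G.deleteEdges (M : Set (Sym2 V))).degOut S x : ℝ) - (a - degH M x)) =
        (G.degOut S x : ℝ) + eHxS M x S - a := by
      have := congrArg (Nat.cast (R := ℝ)) (G.degMinusH_add_degH hM S x)
      push_cast at this
      rw [SimpleGraph.degOut_deleteEdges]
      linarith
    simp only [this]
  simp only [hcond] at key
  rw [← key]
  constructor
  · rintro ⟨h, ⟨h01, hh⟩, h1⟩
    refine ⟨h, fun e he => h01 e ((G.deleteEdges_le _ |> edgeSet_mono) he), fun u => ?_⟩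
    have := hh u
    rw [G.sum_incidenceFinset_eq_sum_neighborFinset,
      G.sum_neighborFinset_eq_deleteEdges_add_degH hM h h1] at this
    constructor <;> linarith [this.1, this.2]
  · rintro ⟨h, h01, hh⟩
    have h1 : ∀ e ∈ M, (fun e => if e ∈ M then 1 else h e) e = 1 := fun e he => by simp [he]
    refine ⟨_, ⟨fun e he => ?_, fun u => ?_⟩, h1⟩
    · by_cases heM : e ∈ M
      · simp [heM]
      · simpa [heM] using h01 e (by simpa [heM] using he)
    · rw [G.sum_incidenceFinset_eq_sum_neighborFinset,
        G.sum_neighborFinset_eq_deleteEdges_add_degH hM _ h1]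
      have : ∑ v ∈ (G.deleteEdges (M : Set (Sym2 V))).neighborFinset u,
          (if s(u, v) ∈ M then 1 else h s(u, v)) =
          ∑ v ∈ (G.deleteEdges (M : Set (Sym2 V))).neighborFinset u, h s(u, v) := by
        refine Finset.sum_congr rfl fun v hv => if_neg ?_
        simp only [mem_neighborFinset, deleteEdges_adj, mem_coe] at hv
        exact hv.2
      have hu := hh u
      simp only [this]
      constructor <;> linarith [hu.1, hu.2]

theorem SimpleGraph.disjoint_Tset (G : SimpleGraph V) [DecidableRel G.Adj] (a : ℕ)
    (S : Finset V) : Disjoint S (G.Tset a S) := by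
  rw [Finset.disjoint_right]
  intro x hx
  exact (Finset.mem_filter.1 hx).2.1

theorem SimpleGraph.theta_Tset_eq (G : SimpleGraph V) [DecidableRel G.Adj] {a : ℕ} (ha : 1 ≤ a)
    {M : Finset (Sym2 V)} (hM : ↑M ⊆ G.edgeSet) (S : Finset V) :
    G.theta a M S (G.Tset a S) =
      ∑ x ∈ G.Tset a S, max 0 ((G.degOut S x : ℤ) + eHxS M x S - a) := by
  rw [SimpleGraph.theta, Finset.sum_filter]
  refine Finset.sum_congr rfl fun x hx => ?_
  have hd := (Finset.mem_filter.1 hx).2.2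
  have := G.degMinusH_add_degH hM S x
  split_ifs <;> omega

/-- For fixed `S`, the cut inequality is tightest at `T = G.Tset a S`, restricted to the vertices
with negative contribution. -/
theorem SimpleGraph.forall_cut_nonneg_iff (G : SimpleGraph V) [DecidableRel G.Adj] {a : ℕ}
    (b : ℕ) (ha : 1 ≤ a) {M : Finset (Sym2 V)} (hM : ↑M ⊆ G.edgeSet) (S : Finset V) :
    (∀ T : Finset V, Disjoint S T →
        0 ≤ ∑ x ∈ S, ((b : ℤ) - degH M x) +
          ∑ x ∈ T, ((G.degOut S x : ℤ) + eHxS M x S - a)) ↔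
      (∑ x ∈ S, (degH M x : ℤ)) - (eHTS M (G.Tset a S) S : ℤ) +
          G.theta a M S (G.Tset a S) ≤
        (∑ v ∈ G.Tset a S, (G.degOut S v : ℤ)) - (a : ℤ) * (G.Tset a S).card +
          (b : ℤ) * S.card := by
  let t (x : V) : ℤ := (G.degOut S x : ℤ) + eHxS M x S - a
  have hdisj := G.disjoint_Tset a S
  have hsum : ∑ x ∈ G.Tset a S, min 0 (t x) =
      (∑ v ∈ G.Tset a S, (G.degOut S v : ℤ)) - (a : ℤ) * (G.Tset a S).card +
        (eHTS M (G.Tset a S) S : ℤ) - G.theta a M S (G.Tset a S) := by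
    have hmin (x : V) : min 0 (t x) = t x - max 0 (t x) := by omega
    rw [G.theta_Tset_eq ha hM, eHTS_eq_sum_eHxS M hdisj]
    simp only [hmin, t, Finset.sum_sub_distrib, Finset.sum_add_distrib, Finset.sum_const,
      nsmul_eq_mul]
    push_cast
    ring
  have hS : ∑ x ∈ S, ((b : ℤ) - degH M x) = (b : ℤ) * S.card - ∑ x ∈ S, (degH M x : ℤ) := by
    rw [Finset.sum_sub_distrib, Finset.sum_const, nsmul_eq_mul, mul_comm]
  rw [hS]
  constructor
  · intro h
    have h₁ := h ((G.Tset a S).filter fun x => t x < 0)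
      (hdisj.mono_right (Finset.filter_subset _ _))
    have h₂ : ∑ x ∈ (G.Tset a S).filter (fun x => t x < 0), t x =
        ∑ x ∈ G.Tset a S, min 0 (t x) := by
      rw [Finset.sum_filter]
      refine Finset.sum_congr rfl fun x _ => ?_
      split_ifs <;> omega
    change 0 ≤ _ + ∑ x ∈ (G.Tset a S).filter (fun x => t x < 0), t x at h₁
    linarith
  · intro h T hT
    have h₁ : ∑ x ∈ G.Tset a S, min 0 (t x) ≤ ∑ x ∈ T, t x := by
      calc ∑ x ∈ G.Tset a S, min 0 (t x)
          ≤ ∑ x ∈ G.Tset a S ∩ T, min 0 (t x) := by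
            rw [← Finset.sum_inter_add_sum_sdiff (G.Tset a S) T]
            have := Finset.sum_nonpos (s := G.Tset a S \ T) (f := fun x => min 0 (t x))
              fun x _ => min_le_left _ _
            linarith
        _ ≤ ∑ x ∈ G.Tset a S ∩ T, t x := Finset.sum_le_sum fun x _ => min_le_right _ _
        _ ≤ ∑ x ∈ T, t x := by
            refine Finset.sum_le_sum_of_subset_of_nonneg Finset.inter_subset_right ?_
            intro x hx hx'
            have hxT : x ∉ G.Tset a S := fun h => hx' (Finset.mem_inter.2 ⟨h, hx⟩)
            have hxS : x ∉ S := Finset.disjoint_right.1 hT hx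
            simp only [SimpleGraph.Tset, mem_filter, mem_univ, true_and, hxS,
              not_false_eq_true] at hxT
            simp only [t]
            omega
    change 0 ≤ _ + ∑ x ∈ T, t x
    linarith

/-- the Gao–Wang criterion. A graph `G` with at least `m` edges is fractional
`(a,b,m)`-covered iff for every `S ⊆ V(G)` the deficiency inequality holds against every
subgraph `H` of `G` with exactly `m` edges (so the left side dominates the maximum over
all such `H`). -/
theorem fracABMCovered_iff
    (G : SimpleGraph V) [DecidableRel G.Adj]
    (a b m : ℕ) (ha : 1 ≤ a) (hab : a ≤ b) (hmb : m ≤ b)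
    (hGm : m ≤ G.edgeFinset.card) :
    G.IsFracABMCovered a b m ↔
      ∀ S : Finset V, ∀ M : Finset (Sym2 V), ↑M ⊆ G.edgeSet → M.card = m →
        (∑ x ∈ S, (degH M x : ℤ)) - (eHTS M (G.Tset a S) S : ℤ) +
            G.theta a M S (G.Tset a S) ≤
          (∑ v ∈ G.Tset a S, (G.degOut S v : ℤ)) - (a : ℤ) * (G.Tset a S).card +
            (b : ℤ) * S.card := by
  have key (M : Finset (Sym2 V)) (hM : ↑M ⊆ G.edgeSet) :=
    G.exists_isFracFactor_eq_one_iff hab hM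
  constructor
  · intro h S M hM hm
    exact (G.forall_cut_nonneg_iff b ha hM S).1 ((key M hM).1 (h M hM hm) S)
  · intro h M hM hm
    exact (key M hM).2 fun S => (G.forall_cut_nonneg_iff b ha hM S).2 (h S M hM hm)
end

section
/- Let G be a finite simple graph on n vertices and m edges with minimum degree δ ≥ 1. Then the spectral radius satisfies ρ(G) ≤ (δ − 1)/2 + sqrt(2m − nδ + (δ + 1)²/4). -/
open Finset

/-- The spectral radius of a finite simple graph: the largest eigenvalue (as a supremum of
the set of eigenvalues) of its adjacency matrix. -/
noncomputable def SimpleGraph.specRad {V : Type*} [Fintype V] [DecidableEq V]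
    (G : SimpleGraph V) : ℝ :=
  letI := Classical.decRel G.Adj
  sSup {μ : ℝ | Module.End.HasEigenvalue (Matrix.toLin' (G.adjMatrix ℝ)) μ}

namespace SimpleGraph

variable {V : Type*} [Fintype V] (G : SimpleGraph V) [DecidableRel G.Adj]

theorem sum_sum_neighborFinset_comm {M : Type*} [AddCommMonoid M] (f : V → V → M) :
    ∑ u, ∑ w ∈ G.neighborFinset u, f u w = ∑ w, ∑ u ∈ G.neighborFinset w, f u w :=
  Finset.sum_comm' fun u w => by simp [G.adj_comm]

theorem sum_degree_neighborFinset_le (v : V) :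
    ∑ u ∈ G.neighborFinset v, (G.degree u : ℝ) ≤
      2 * (G.edgeFinset.card : ℝ) - (Fintype.card V : ℝ) * G.minDegree + G.minDegree +
        ((G.minDegree : ℝ) - 1) * G.degree v := by
  classical
  have h : ∑ u ∈ insert v (G.neighborFinset v), ((G.degree u : ℝ) - G.minDegree) ≤
      ∑ u, ((G.degree u : ℝ) - G.minDegree) :=
    Finset.sum_le_univ_sum_of_nonneg fun u =>
      sub_nonneg.2 (by exact_mod_cast G.minDegree_le_degree u)
  have hm : ∑ u, (G.degree u : ℝ) = 2 * G.edgeFinset.card := by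
    exact_mod_cast G.sum_degrees_eq_twice_card_edges
  rw [Finset.sum_insert (by simp), Finset.sum_sub_distrib, Finset.sum_sub_distrib, hm] at h
  simp only [Finset.sum_const, nsmul_eq_mul, card_neighborFinset_eq_degree,
    Finset.card_univ] at h
  linarith

/-- The quadratic inequality holds for every `μ ≥ 0` admitting a nonzero nonnegative vector `x`
with `μ x ≤ A x`, where `A` is the adjacency matrix. -/
theorem sq_sub_mul_le_of_subeigenvector {x : V → ℝ} {μ : ℝ} (hμ : 0 ≤ μ) (hx : ∀ v, 0 ≤ x v)
    (hpos : 0 < ∑ v, x v) (hsub : ∀ v, μ * x v ≤ ∑ u ∈ G.neighborFinset v, x u) :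
    μ ^ 2 - ((G.minDegree : ℝ) - 1) * μ ≤
      2 * (G.edgeFinset.card : ℝ) - (Fintype.card V : ℝ) * G.minDegree + G.minDegree := by
  set δ : ℝ := (G.minDegree : ℝ)
  set C : ℝ := 2 * (G.edgeFinset.card : ℝ) - (Fintype.card V : ℝ) * δ + δ
  set g : V → ℝ := fun v => ∑ u ∈ G.neighborFinset v, x u with hg
  have hdx : ∑ v, g v = ∑ v, G.degree v * x v := by
    simp [hg, G.sum_sum_neighborFinset_comm fun _ w => x w]
  have hdg : ∑ v, G.degree v * g v ≤ C * ∑ v, x v + (δ - 1) * ∑ v, g v := by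
    calc ∑ v, G.degree v * g v
        = ∑ w, (∑ u ∈ G.neighborFinset w, (G.degree u : ℝ)) * x w := by
          simp only [hg, Finset.mul_sum, Finset.sum_mul]
          exact G.sum_sum_neighborFinset_comm fun u w => (G.degree u : ℝ) * x w
      _ ≤ ∑ w, (C + (δ - 1) * G.degree w) * x w :=
          Finset.sum_le_sum fun w _ =>
            mul_le_mul_of_nonneg_right (G.sum_degree_neighborFinset_le w) (hx w)
      _ = C * ∑ v, x v + (δ - 1) * ∑ v, g v := by
          rw [hdx, Finset.mul_sum, Finset.mul_sum, ← Finset.sum_add_distrib]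
          exact Finset.sum_congr rfl fun w _ => by ring
  have hexcess : 0 ≤ ∑ v, ((G.degree v : ℝ) - (δ - 1)) * (g v - μ * x v) :=
    Finset.sum_nonneg fun v _ => by
      have h : δ ≤ G.degree v := Nat.cast_le.2 (G.minDegree_le_degree v)
      exact mul_nonneg (by linarith) (sub_nonneg.2 (hsub v))
  have hexpand : ∑ v, ((G.degree v : ℝ) - (δ - 1)) * (g v - μ * x v) =
      ∑ v, G.degree v * g v - (δ - 1) * ∑ v, g v - μ * ∑ v, g v +
        (δ - 1) * μ * ∑ v, x v := by
    conv_rhs => rw [show μ * ∑ v, g v = μ * ∑ v, G.degree v * x v by rw [hdx]]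
    simp only [Finset.mul_sum, ← Finset.sum_sub_distrib, ← Finset.sum_add_distrib]
    exact Finset.sum_congr rfl fun v _ => by ring
  have hsum : μ * ∑ v, x v ≤ ∑ v, g v := by
    rw [Finset.mul_sum]
    exact Finset.sum_le_sum fun v _ => hsub v
  have hmul := mul_le_mul_of_nonneg_left hsum hμ
  refine le_of_mul_le_mul_right ?_ hpos
  linarith

theorem mul_abs_le_sum_abs_of_adjMatrix_mulVec {y : V → ℝ} {μ : ℝ} (hμ : 0 ≤ μ)
    (hy : (G.adjMatrix ℝ).mulVec y = μ • y) (v : V) :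
    μ * |y v| ≤ ∑ u ∈ G.neighborFinset v, |y u| := by
  have h := congrFun hy v
  rw [adjMatrix_mulVec_apply, Pi.smul_apply, smul_eq_mul] at h
  calc μ * |y v| = |∑ u ∈ G.neighborFinset v, y u| := by rw [h, abs_mul, abs_of_nonneg hμ]
    _ ≤ _ := Finset.abs_sum_le_sum_abs _ _

end SimpleGraph

/-- the Hong-type bound. For a graph on `n` vertices with `m` edges and minimum
degree `δ ≥ 1`, `ρ(G) ≤ (δ − 1)/2 + sqrt(2m − nδ + (δ + 1)²/4)`. -/
theorem specRad_le_of_minDegree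
    {V : Type*} [Fintype V] [DecidableEq V] (G : SimpleGraph V) [DecidableRel G.Adj]
    (hδ : 1 ≤ G.minDegree) :
    G.specRad ≤ ((G.minDegree : ℝ) - 1) / 2 +
      Real.sqrt (2 * (G.edgeFinset.card : ℝ) -
        (Fintype.card V : ℝ) * (G.minDegree : ℝ) + ((G.minDegree : ℝ) + 1) ^ 2 / 4) := by
  have hδ' : (1 : ℝ) ≤ G.minDegree := by exact_mod_cast hδ
  have hRHS : 0 ≤ ((G.minDegree : ℝ) - 1) / 2 := by linarith
  refine Real.sSup_le (fun μ hμ => ?_) (add_nonneg hRHS (Real.sqrt_nonneg _))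
  rcases le_total μ 0 with hneg | hnonneg
  · exact hneg.trans (add_nonneg hRHS (Real.sqrt_nonneg _))
  obtain ⟨y, hy⟩ := hμ.exists_hasEigenvector
  have hAy : (G.adjMatrix ℝ).mulVec y = μ • y := by
    have h := hy.apply_eq_smul
    rw [Matrix.toLin'_apply] at h
    convert h
    rfl
  have hpos : 0 < ∑ v, |y v| := by
    obtain ⟨v, hv⟩ := Function.ne_iff.1 hy.2
    exact Finset.sum_pos' (fun u _ => abs_nonneg _) ⟨v, Finset.mem_univ v, abs_pos.2 hv⟩
  have hquad := G.sq_sub_mul_le_of_subeigenvector hnonneg (fun v => abs_nonneg (y v)) hpos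
    (G.mul_abs_le_sum_abs_of_adjMatrix_mulVec hnonneg hAy)
  rw [← sub_le_iff_le_add']
  apply Real.le_sqrt_of_sq_le
  linarith
end

section
/- Let a, b, m, n be integers with 2 ≤ a ≤ b, 1 ≤ m ≤ b, and n ≥ (4b + 2a + ab + (b+8)m + 16)/2, and define g(t) = −3t² + (2n + 2b − 2a − 2m + 1)t + b² + ab + (3b − 4)m − 2bn − b + 2. Then g(t) > 0 for every real number t with b + 1 ≤ t ≤ n/2. -/
/-- A concave quadratic that is positive at both ends of an interval is positive on it. -/
theorem quadratic_pos_of_endpoints_pos {k l c p q t : ℝ} (hk : k ≤ 0)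
    (hp : 0 < k * p ^ 2 + l * p + c) (hq : 0 < k * q ^ 2 + l * q + c)
    (hpt : p ≤ t) (htq : t ≤ q) : 0 < k * t ^ 2 + l * t + c := by
  rcases hpt.eq_or_lt with rfl | hpt
  · exact hp
  have h1 := mul_nonneg hp.le (sub_nonneg.2 htq)
  have h2 := mul_pos hq (sub_pos.2 hpt)
  have h3 := mul_nonneg (neg_nonneg.2 hk) (mul_nonneg (mul_nonneg (sub_pos.2 hpt).le
    (sub_nonneg.2 htq)) (sub_pos.2 (hpt.trans_le htq)).le)
  refine pos_of_mul_pos_left ?_ (sub_pos.2 (hpt.trans_le htq)).le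
  linarith

/-- Positivity, up to a factor of four, of the quadratic at the right endpoint `n / 2`. -/
theorem right_endpoint_pos {a b m n : ℤ} (ha : 2 ≤ a) (hab : a ≤ b) (hm : 1 ≤ m)
    (hn : 4 * b + 2 * a + a * b + (b + 8) * m + 16 ≤ 2 * n) :
    0 < n * (n - 4 * (a + b + m) + 2) +
      4 * (b ^ 2 + a * b + (3 * b - 4) * m - b + 2) := by
  have hbm : b ≤ b * m := le_mul_of_one_le_right (by lia) hm
  have hab0 : 0 ≤ a * b := mul_nonneg (by lia) (by lia)
  have hn0 : 0 ≤ n := by nlinarith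
  have hconst : 0 < b ^ 2 + a * b + (3 * b - 4) * m - b + 2 := by nlinarith
  by_cases hd : 0 ≤ n - 4 * (a + b + m) + 2
  · have := mul_nonneg hn0 hd
    lia
  obtain rfl | ha3 := ha.eq_or_lt
  · obtain rfl | hm2 := hm.eq_or_lt
    · have hx : 3 * b + 18 ≤ 2 * (n - 2 * b - 5) := by lia
      nlinarith [mul_self_le_mul_self (by lia : 0 ≤ 3 * b + 18) hx]
    · nlinarith
  · exfalso
    have hkey : 0 ≤ (b - 6) * (a - 3) + 2 := by
      by_cases hb : 6 ≤ b
      · nlinarith [mul_nonneg (sub_nonneg.2 hb) (by lia : 0 ≤ a - 3)]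
      · have hb5 : b ≤ 5 := by lia
        have hb3 : 3 ≤ b := by lia
        interval_cases b <;> lia
    nlinarith

/-- for integers `2 ≤ a ≤ b`, `1 ≤ m ≤ b`, and
`n ≥ (4b + 2a + ab + (b+8)m + 16)/2`, the quadratic
`g(t) = −3t² + (2n + 2b − 2a − 2m + 1)t + b² + ab + (3b − 4)m − 2bn − b + 2`
is positive for all real `t` with `b + 1 ≤ t ≤ n/2`. -/
theorem g_pos (a b m n : ℤ) (ha : 2 ≤ a) (hab : a ≤ b) (hm1 : 1 ≤ m) (hmb : m ≤ b)
    (hn : ((4 * b + 2 * a + a * b + (b + 8) * m + 16 : ℤ) : ℝ) / 2 ≤ (n : ℝ)) :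
    ∀ t : ℝ, (b : ℝ) + 1 ≤ t → t ≤ (n : ℝ) / 2 →
      0 < -3 * t ^ 2 + (2 * (n : ℝ) + 2 * (b : ℝ) - 2 * (a : ℝ) - 2 * (m : ℝ) + 1) * t +
        (b : ℝ) ^ 2 + (a : ℝ) * (b : ℝ) + (3 * (b : ℝ) - 4) * (m : ℝ) -
        2 * (b : ℝ) * (n : ℝ) - (b : ℝ) + 2 := by
  intro t ht htn
  have hn' : 4 * b + 2 * a + a * b + (b + 8) * m + 16 ≤ 2 * n := by
    rw [div_le_iff₀ (by norm_num)] at hn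
    have : 4 * b + 2 * a + a * b + (b + 8) * m + 16 ≤ n * 2 := by exact_mod_cast hn
    lia
  have hleft : 0 < 2 * n - 4 * b - a * b - 2 * a + m * b - 6 * m := by nlinarith
  have hright := right_endpoint_pos ha hab hm1 hn'
  have hleft' : (0 : ℝ) < 2 * n - 4 * b - a * b - 2 * a + m * b - 6 * m := by
    exact_mod_cast hleft
  have hright' : (0 : ℝ) < n * (n - 4 * (a + b + m) + 2) +
      4 * (b ^ 2 + a * b + (3 * b - 4) * m - b + 2) := by
    exact_mod_cast hright
  have h := quadratic_pos_of_endpoints_pos (k := -3)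
    (l := 2 * (n : ℝ) + 2 * b - 2 * a - 2 * m + 1)
    (c := (b : ℝ) ^ 2 + a * b + (3 * b - 4) * m - 2 * b * n - b + 2)
    (by norm_num) (by linarith) (by linarith) ht htn
  linarith
end

section
/- Let a, b, m, n, s be integers with 2 ≤ a ≤ b, 1 ≤ m ≤ b, n ≥ (4b + 2a + ab + (b+8)m + 16)/2, and s ≥ 0, and define f(t) = −t² + (2n − 2a − 2s − 1)t + b² + ab + (b − 4)m + 2bs − 2bn + b + 2. Then f(t) > 0 for every real number t with t ≥ (n+1)/2, t ≥ b + 1, and s ≤ n − t. -/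
/-- Positivity of the quadratic obtained from `f` by substituting the extremal value
`s = n - t`. -/
lemma reduced_quadratic_pos (a b m : ℤ) (ha : 2 ≤ a) (hab : a ≤ b) (hm1 : 1 ≤ m) (hmb : m ≤ b)
    (t : ℝ) (ht : (5 * b + 2 * a + a * b + 26 : ℝ) / 4 ≤ t) :
    0 < t ^ 2 - (2 * a + 2 * b + 1) * t + b ^ 2 + a * b + (b - 4) * m + b + 2 := by
  have hm1' : (1 : ℝ) ≤ m := mod_cast hm1
  have hmb' : (m : ℝ) ≤ b := mod_cast hmb
  have hb : (2 : ℝ) ≤ b := mod_cast ha.trans hab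
  rcases ha.eq_or_lt with rfl | ha3
  · push_cast at ht ⊢
    nlinarith [mul_nonneg (sub_nonneg.2 ht) (by linarith : (0 : ℝ) ≤ t - b / 4 + 5 / 2),
      mul_nonneg (sub_nonneg.2 hb) (sub_nonneg.2 hm1')]
  · have key : 0 ≤ (a - 3) * (b - 6) + 4 := by
      rcases le_or_gt 6 b with h | h
      · nlinarith [mul_nonneg (by lia : 0 ≤ a - 3) (by lia : 0 ≤ b - 6)]
      · have : 3 ≤ b := by lia
        interval_cases b <;> lia
    have key' : (0 : ℝ) ≤ (a - 3) * (b - 6) + 4 := mod_cast key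
    have ha' : (3 : ℝ) ≤ a := mod_cast ha3
    have ht' : 0 ≤ t - (2 * a + 2 * b + 1) := by linarith
    have ht0 : 0 ≤ t := by linarith
    nlinarith [mul_nonneg ht0 ht', mul_nonneg (sub_nonneg.2 hb) (sub_nonneg.2 hm1'),
      mul_nonneg (sub_nonneg.2 ha') (sub_nonneg.2 hb)]

/-- for integers `2 ≤ a ≤ b`, `1 ≤ m ≤ b`, `s ≥ 0`, and
`n ≥ (4b + 2a + ab + (b+8)m + 16)/2`, the quadratic
`f(t) = −t² + (2n − 2a − 2s − 1)t + b² + ab + (b − 4)m + 2bs − 2bn + b + 2`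
is positive for all real `t` with `t ≥ (n+1)/2`, `t ≥ b + 1` and `s ≤ n − t`. -/
theorem f_pos_case2 (a b m n s : ℤ) (ha : 2 ≤ a) (hab : a ≤ b) (hm1 : 1 ≤ m) (hmb : m ≤ b)
    (hn : ((4 * b + 2 * a + a * b + (b + 8) * m + 16 : ℤ) : ℝ) / 2 ≤ (n : ℝ))
    (hs : 0 ≤ s) :
    ∀ t : ℝ, ((n : ℝ) + 1) / 2 ≤ t → (b : ℝ) + 1 ≤ t → (s : ℝ) ≤ (n : ℝ) - t →
      0 < -t ^ 2 + (2 * (n : ℝ) - 2 * (a : ℝ) - 2 * (s : ℝ) - 1) * t +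
        (b : ℝ) ^ 2 + (a : ℝ) * (b : ℝ) + ((b : ℝ) - 4) * (m : ℝ) +
        2 * (b : ℝ) * (s : ℝ) - 2 * (b : ℝ) * (n : ℝ) + (b : ℝ) + 2 := by
  intro t ht hbt hst
  have hm1' : (1 : ℝ) ≤ m := mod_cast hm1
  have hb : (2 : ℝ) ≤ b := mod_cast ha.trans hab
  push_cast at hn
  have ht' : (5 * b + 2 * a + a * b + 26 : ℝ) / 4 ≤ t := by
    nlinarith [mul_nonneg (by linarith : (0 : ℝ) ≤ b + 8) (sub_nonneg.2 hm1')]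
  nlinarith [reduced_quadratic_pos a b m ha hab hm1 hmb t ht',
    mul_nonneg (sub_nonneg.2 hst) (by linarith : (0 : ℝ) ≤ t - b)]
end

section
/- Let a, b, m, n, s be integers with 2 ≤ a ≤ b, 1 ≤ m ≤ b, n ≥ 4a + 5b/2 + 4m + 7, and s ≥ 0, and define f(t) = −t²/2 + (n − a − s − 1/2)t + b²/2 + ab + 3b/2 + (b − 1)m − (b + 1)n + bs + 2a + 2. Then f(t) > 0 for every real number t with t ≥ (n+1)/2 and s ≤ n − t. -/
/-- for integers `2 ≤ a ≤ b`, `1 ≤ m ≤ b`, `s ≥ 0`, and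
`n ≥ 4a + 5b/2 + 4m + 7`, the quadratic
`f(t) = −t²/2 + (n − a − s − 1/2)t + b²/2 + ab + 3b/2 + (b − 1)m − (b + 1)n + bs + 2a + 2`
is positive for all real `t` with `t ≥ (n+1)/2` and `s ≤ n − t`. -/
theorem f_pos_size_case2 (a b m n s : ℤ) (ha : 2 ≤ a) (hab : a ≤ b)
    (hm1 : 1 ≤ m) (hmb : m ≤ b)
    (hn : 4 * (a : ℝ) + 5 * (b : ℝ) / 2 + 4 * (m : ℝ) + 7 ≤ (n : ℝ))
    (hs : 0 ≤ s) :
    ∀ t : ℝ, ((n : ℝ) + 1) / 2 ≤ t → (s : ℝ) ≤ (n : ℝ) - t →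
      0 < -t ^ 2 / 2 + ((n : ℝ) - (a : ℝ) - (s : ℝ) - 1 / 2) * t +
        (b : ℝ) ^ 2 / 2 + (a : ℝ) * (b : ℝ) + 3 * (b : ℝ) / 2 + ((b : ℝ) - 1) * (m : ℝ) -
        ((b : ℝ) + 1) * (n : ℝ) + (b : ℝ) * (s : ℝ) + 2 * (a : ℝ) + 2 := by
  intro t ht hst
  have ha' : (2 : ℝ) ≤ a := by exact_mod_cast ha
  have hab' : (a : ℝ) ≤ b := by exact_mod_cast hab
  have hm' : (1 : ℝ) ≤ m := by exact_mod_cast hm1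
  have hT : 2 * (a : ℝ) + 5 / 4 * b + 2 * m + 4 ≤ t := by linarith
  -- The coefficient `b - t` of `s` is negative, so `s = n - t` is the worst case.
  have h_s : 0 ≤ ((n : ℝ) - t - s) * (t - b) :=
    mul_nonneg (by linarith) (by linarith)
  -- For `s = n - t` and `n = 2t - 1` the quadratic increases beyond this bound on `t`.
  have h_t : 0 ≤ (t - (2 * (a : ℝ) + 5 / 4 * b + 2 * m + 4)) *
      (t + (2 * (a : ℝ) + 5 / 4 * b + 2 * m + 4) - 2 * (a + b + 5 / 2)) :=
    mul_nonneg (by linarith) (by linarith)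
  have h_end : 0 < (2 * (a : ℝ) + 5 / 4 * b + 2 * m + 4) * (m - 3 / 8 * b - 1 / 2) +
      (b : ℝ) ^ 2 / 2 + a * b + 3 * b / 2 + (b - 1) * m + 2 * a + 3 := by
    have hma : 0 ≤ ((m : ℝ) - 1) * (a - 2) := mul_nonneg (by linarith) (by linarith)
    have hmb' : 0 ≤ ((m : ℝ) - 1) * (b - 2) := mul_nonneg (by linarith) (by linarith)
    have hab₂ : 0 ≤ ((a : ℝ) - 2) * (b - 2) := mul_nonneg (by linarith) (by linarith)
    nlinarith [sq_nonneg ((m : ℝ) - 1), sq_nonneg (b : ℝ)]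
  nlinarith [h_s, h_t, h_end]
end
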